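/- For every real x with 0 < x ≤ 1, the limit as n → ∞ of n · Σ_{k=1}^{n} p_{n,k}(x) · ( sqrt(k(k-1)/(n(n-1))) - k/n ) equals -(1-x)/2. -/

import Mathlib

open Filter Finset

/-- Bernstein basis polynomial `p_{n,k}(x) = C(n,k) x^k (1-x)^{n-k}`. -/
noncomputable def bern (n k : ℕ) (x : ℝ) : ℝ := (n.choose k : ℝ) * x ^ k * (1 - x) ^ (n - k)

theorem bern_eq_eval (n k : ℕ) (x : ℝ) : bern n k x = (bernsteinPolynomial ℝ n k).eval x := by
  simp [bern, bernsteinPolynomial]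

theorem bern_nonneg {x : ℝ} (hx0 : 0 ≤ x) (hx1 : x ≤ 1) (n k : ℕ) : 0 ≤ bern n k x := by
  have : 0 ≤ 1 - x := sub_nonneg.2 hx1
  unfold bern
  positivity

theorem sum_bern (n : ℕ) (x : ℝ) : ∑ k ∈ range (n + 1), bern n k x = 1 := by
  simpa [Polynomial.eval_finsetSum, bern_eq_eval] using
    congrArg (Polynomial.eval x) (bernsteinPolynomial.sum ℝ n)

theorem sum_bern_mul (n : ℕ) (x : ℝ) : ∑ k ∈ range (n + 1), bern n k x * k = n * x := by
  simpa [Polynomial.eval_finsetSum, bern_eq_eval, mul_comm] using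
    congrArg (Polynomial.eval x) (bernsteinPolynomial.sum_smul ℝ n)

theorem sum_range_succ_eq_add_sum_Icc (f : ℕ → ℝ) (n : ℕ) :
    ∑ k ∈ range (n + 1), f k = f 0 + ∑ k ∈ Icc 1 n, f k := by
  rw [range_eq_Ico, sum_eq_sum_Ico_succ_bot (Nat.succ_pos n)]
  rfl

theorem bern_succ_succ (n k : ℕ) (x : ℝ) :
    bern (n + 1) (k + 1) x = (n + 1) * x * (bern n k x / (k + 1)) := by
  have h : ((n : ℝ) + 1) * n.choose k = (n + 1).choose (k + 1) * (k + 1) := by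
    exact_mod_cast Nat.add_one_mul_choose_eq n k
  have hk : (k : ℝ) + 1 ≠ 0 := by positivity
  have hc : ((n + 1).choose (k + 1) : ℝ) = (n + 1) * n.choose k / (k + 1) := by
    rw [h, mul_div_cancel_right₀ _ hk]
  unfold bern
  rw [hc, Nat.add_sub_add_right, pow_succ]
  ring

theorem sum_bern_div_succ_le {x : ℝ} (hx0 : 0 < x) (hx1 : x ≤ 1) (n : ℕ) :
    ∑ k ∈ Icc 1 n, bern n k x / (k + 1) ≤ 1 / ((n + 1) * x) := by
  rw [le_div_iff₀ (by positivity), mul_comm, mul_sum]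
  have h1 := sum_bern (n + 1) x
  rw [sum_range_succ'] at h1
  simp only [bern_succ_succ] at h1
  rw [sum_range_succ_eq_add_sum_Icc] at h1
  have h2 := bern_nonneg hx0.le hx1 (n + 1) 0
  have h3 := bern_nonneg hx0.le hx1 n 0
  have h4 : 0 ≤ (n + 1) * x * (bern n 0 x / ((0 : ℕ) + 1)) := by positivity
  linarith

/-- The expansion `√(k(k-1)/(n(n-1))) = k/n - (1 - k/n)/(2(n-1)) + O(1/k)/n`, made explicit. -/
theorem abs_mul_sqrt_sub_add_le {n k : ℕ} (hn : 2 ≤ n) (hk : 1 ≤ k) (hkn : k ≤ n) :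
    |(n : ℝ) * (Real.sqrt ((k * (k - 1)) / (n * (n - 1))) - (k : ℝ) / n) +
      n / (n - 1) * (1 - k / n) / 2| ≤ (n / (n - 1)) ^ 2 * (1 / (k + 1)) := by
  have hn' : (2 : ℝ) ≤ n := by exact_mod_cast hn
  have hk' : (1 : ℝ) ≤ k := by exact_mod_cast hk
  have hkn' : (k : ℝ) ≤ n := by exact_mod_cast hkn
  have hm : (0 : ℝ) < n - 1 := by linarith
  have hn0 : (0 : ℝ) < n := by linarith
  have hk0 : (0 : ℝ) < k := by linarith
  set s := Real.sqrt ((k * (k - 1)) / (n * (n - 1)) : ℝ) with hs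
  have hs0 : 0 ≤ s := Real.sqrt_nonneg _
  have hsq : s ^ 2 = (k * (k - 1)) / (n * (n - 1)) :=
    Real.sq_sqrt (div_nonneg (mul_nonneg hk0.le (by linarith)) (by positivity))
  obtain ⟨d, hd⟩ : ∃ d, d = (k : ℝ) / n - s := ⟨_, rfl⟩
  have hsd : s = k / n - d := by linarith
  have key : d * (k / n + s) = k / n * ((1 - k / n) / (n - 1)) := by
    have : d * (k / n + s) = (k / n) ^ 2 - s ^ 2 := by rw [hd]; ring
    rw [this, hsq]
    field_simp
    ring
  have ha : (0 : ℝ) < k / n := by positivity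
  have ha1 : (k : ℝ) / n ≤ 1 := (div_le_one hn0).2 hkn'
  have hd0 : 0 ≤ d := by
    have : 0 ≤ d * (k / n + s) := by
      rw [key]
      exact mul_nonneg ha.le (div_nonneg (by linarith) hm.le)
    exact nonneg_of_mul_nonneg_left this (by linarith)
  have hd1 : d ≤ 1 / (n - 1) := by
    have h1 : d ≤ (1 - k / n) / (n - 1) := by
      refine le_of_mul_le_mul_left ?_ ha
      rw [← key]
      nlinarith [mul_nonneg hd0 hs0]
    exact h1.trans (by gcongr; linarith)
  have herr : (n : ℝ) * (s - k / n) + n / (n - 1) * (1 - k / n) / 2 =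
      -(n ^ 2 * d ^ 2 * (1 / (2 * k))) := by
    have h2 : (1 - (k : ℝ) / n) / (n - 1) = n / k * (d * (2 * (k / n) - d)) := by
      have h3 : d * (2 * (k / n) - d) = k / n * ((1 - k / n) / (n - 1)) := by
        rw [← key, hsd]; ring
      rw [h3]
      field_simp
    have h4 : (n : ℝ) / (n - 1) * (1 - k / n) / 2 = n / 2 * ((1 - (k : ℝ) / n) / (n - 1)) := by
      ring
    rw [h4, h2, hsd]
    field_simp
    ring
  rw [herr, abs_neg, abs_of_nonneg (by positivity)]
  calc (n : ℝ) ^ 2 * d ^ 2 * (1 / (2 * k))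
      ≤ (n : ℝ) ^ 2 * (1 / ((n : ℝ) - 1)) ^ 2 * (1 / ((k : ℝ) + 1)) := by gcongr; linarith
    _ = ((n : ℝ) / (n - 1)) ^ 2 * (1 / ((k : ℝ) + 1)) := by ring

theorem sum_bern_mul_one_sub (n : ℕ) (hn : n ≠ 0) (x : ℝ) :
    ∑ k ∈ Icc 1 n, bern n k x * (1 - (k : ℝ) / n) = (1 - x) - (1 - x) ^ n := by
  have h := sum_range_succ_eq_add_sum_Icc (fun k => bern n k x * (1 - k / n)) n
  have h0 : bern n 0 x = (1 - x) ^ n := by simp [bern]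
  have h1 : ∑ k ∈ range (n + 1), bern n k x * (1 - (k : ℝ) / n) = 1 - x := by
    have : ∀ k : ℕ, bern n k x * (1 - (k : ℝ) / n) = bern n k x - bern n k x * k / n :=
      fun k => by ring
    simp only [this]
    rw [sum_sub_distrib, ← sum_div, sum_bern, sum_bern_mul,
      mul_div_cancel_left₀ _ (Nat.cast_ne_zero.2 hn)]
  simp only [h0, h1, Nat.cast_zero, zero_div, sub_zero, mul_one] at h
  linarith

theorem abs_mul_sum_bern_sqrt_le {x : ℝ} (hx0 : 0 < x) (hx1 : x ≤ 1) {n : ℕ} (hn : 2 ≤ n) :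
    |(n : ℝ) * ∑ k ∈ Icc 1 n,
        bern n k x * (Real.sqrt ((k * (k - 1)) / (n * (n - 1))) - (k : ℝ) / n) +
      n / (n - 1) * ((1 - x) - (1 - x) ^ n) / 2| ≤
      (n / (n - 1)) ^ 2 * (1 / ((n + 1) * x)) := by
  rw [← sum_bern_mul_one_sub n (by omega) x, mul_sum, mul_sum, sum_div, ← sum_add_distrib]
  calc _ ≤ ∑ k ∈ Icc 1 n, ((n : ℝ) / (n - 1)) ^ 2 * (bern n k x / (k + 1)) := by
        refine (abs_sum_le_sum_abs _ _).trans (sum_le_sum fun k hk => ?_)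
        obtain ⟨hk1, hkn⟩ := mem_Icc.1 hk
        have hb := bern_nonneg hx0.le hx1 n k
        have h := mul_le_mul_of_nonneg_left (abs_mul_sqrt_sub_add_le hn hk1 hkn) hb
        rw [← abs_of_nonneg hb, ← abs_mul, abs_of_nonneg hb] at h
        convert h using 1
        · congr 1; ring
        · ring
    _ ≤ _ := by
        rw [← mul_sum]
        exact mul_le_mul_of_nonneg_left (sum_bern_div_succ_le hx0 hx1 n) (sq_nonneg _)

theorem stmt_4 (x : ℝ) (hx0 : 0 < x) (hx1 : x ≤ 1) :
    Tendsto (fun n : ℕ => (n : ℝ) * ∑ k ∈ Finset.Icc 1 n,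
        bern n k x * (Real.sqrt ((k * (k - 1)) / (n * (n - 1))) - (k : ℝ) / n))
      atTop (nhds (-(1 - x) / 2)) := by
  have hratio : Tendsto (fun n : ℕ => (n : ℝ) / (n - 1)) atTop (nhds 1) := by
    simpa [sub_eq_add_neg] using tendsto_natCast_div_add_atTop (-1 : ℝ)
  have hpow : Tendsto (fun n : ℕ => (1 - x) ^ n) atTop (nhds 0) :=
    tendsto_pow_atTop_nhds_zero_of_lt_one (by linarith) (by linarith)
  have hmain := (hratio.mul (tendsto_const_nhds (x := 1 - x).sub hpow)).div_const 2
  have hbound : Tendsto (fun n : ℕ => ((n : ℝ) / (n - 1)) ^ 2 * (1 / ((n + 1) * x)))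
      atTop (nhds 0) := by
    have h := (hratio.pow 2).mul
      ((tendsto_one_div_add_atTop_nhds_zero_nat (𝕜 := ℝ)).mul_const (1 / x))
    simpa [mul_comm] using h
  have herr : Tendsto (fun n : ℕ => (n : ℝ) * ∑ k ∈ Icc 1 n,
        bern n k x * (Real.sqrt ((k * (k - 1)) / (n * (n - 1))) - (k : ℝ) / n) +
      n / (n - 1) * ((1 - x) - (1 - x) ^ n) / 2) atTop (nhds 0) :=
    squeeze_zero_norm' (eventually_atTop.2
      ⟨2, fun n hn => abs_mul_sum_bern_sqrt_le hx0 hx1 hn⟩) hbound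
  convert herr.sub hmain using 2
  · ring
  · ring
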